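/- arXiv:2007.10432 — 2 statements merged into one kernel-verified Lean document; each statement's English description precedes it below -/
import Mathlib

section
/- In the 3×3 ARUM with strict one-to-one targeting, let 𝒞₁ := C_{010} ∪ C_{012} ∪ C_{112} ∪ C_{212} (1-compliers) and 𝒞₂ := C_{002} ∪ C_{012} ∪ C_{112} ∪ C_{212} (2-compliers), each of positive probability. Assume the homogeneity conditions E[Y(1) − Y(0) | C_{112}] = E[Y(1) − Y(0) | 𝒞₁] and E[Y(2) − Y(0) | C_{212}] = E[Y(2) − Y(0) | 𝒞₂], and the rank condition P(C_{010} ∪ C_{012} ∪ C_{212}) · P(C_{002} ∪ C_{012} ∪ C_{112}) ≠ P(C_{212}) · P(C_{112}). Then any reals β₀, β₁, β₂ satisfying the moment conditions E[(Y − β₀ − β₁·1(T = 1) − β₂·1(T = 2)) · 1(Z = z)] = 0 for z = 0, 1, 2 satisfy β₁ = E[Y(1) − Y(0) | 𝒞₁] and β₂ = E[Y(2) − Y(0) | 𝒞₂]. -/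
open MeasureTheory ProbabilityTheory

noncomputable section

variable {Ω : Type*} [MeasurableSpace Ω]

/-- Probability of an event, as a real number. -/
def prr (P : Measure Ω) (A : Set Ω) : ℝ := (P A).toReal

/-- Conditional expectation `E[X | C]` of `X` given the event `C`. -/
def cexp (P : Measure Ω) (X : Ω → ℝ) (C : Set Ω) : ℝ :=
  (∫ ω in C, X ω ∂P) / prr P C

/-- Conditional probability `P(D = d | Z = z)` (generalized propensity score). -/
def pscore {𝒟 𝒵 : Type*} (P : Measure Ω) (D : Ω → 𝒟) (Z : Ω → 𝒵) (d : 𝒟) (z : 𝒵) : ℝ :=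
  prr P ({ω | D ω = d} ∩ {ω | Z ω = z}) / prr P {ω | Z ω = z}

/-- Conditional average outcome `Ē_z(d) = E[Y·1(D = d) | Z = z]`. -/
def ebar {𝒟 𝒵 : Type*} (P : Measure Ω) (D : Ω → 𝒟) (Z : Ω → 𝒵) (Yobs : Ω → ℝ)
    (z : 𝒵) (d : 𝒟) : ℝ :=
  (∫ ω in {ω | D ω = d} ∩ {ω | Z ω = z}, Yobs ω ∂P) / prr P {ω | Z ω = z}

/-- Conditional mean outcome `E[Y | Z = z]`. -/
def ecz {𝒵 : Type*} (P : Measure Ω) (Z : Ω → 𝒵) (Yobs : Ω → ℝ) (z : 𝒵) : ℝ :=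
  (∫ ω in {ω | Z ω = z}, Yobs ω ∂P) / prr P {ω | Z ω = z}

/-- Response group `C_{abc} = {T(0) = a, T(1) = b, T(2) = c}` of the 3×3 model. -/
def grp3 {Ω : Type*} (T : Fin 3 → Ω → Fin 3) (a b c : Fin 3) : Set Ω :=
  {ω | T 0 ω = a ∧ T 1 ω = b ∧ T 2 ω = c}

/-- The integral of a function of `X` over a level set of an independent `Z` factors. -/
theorem setIntegral_preimage_eq_mul_of_indepFun {α β : Type*} [MeasurableSpace α]
    [MeasurableSpace β] [MeasurableSingletonClass α] {P : Measure Ω} {Z : Ω → α} {X : Ω → β}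
    (hZ : Measurable Z) (hX : Measurable X) (hind : IndepFun Z X P) (z : α) {g : β → ℝ}
    (hg : Measurable g) :
    ∫ ω in {ω | Z ω = z}, g (X ω) ∂P = prr P {ω | Z ω = z} * ∫ ω, g (X ω) ∂P := by
  have hφ : Measurable (({z} : Set α).indicator (fun _ => (1 : ℝ))) :=
    measurable_const.indicator (measurableSet_singleton z)
  have hms : MeasurableSet {ω | Z ω = z} := hZ (measurableSet_singleton z)
  have key := (hind.comp hφ hg).integral_fun_mul_eq_mul_integral
    (hφ.comp hZ).aestronglyMeasurable (hg.comp hX).aestronglyMeasurable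
  have h1 : (fun ω => (({z} : Set α).indicator (fun _ => (1 : ℝ)) ∘ Z) ω * (g ∘ X) ω)
      = {ω | Z ω = z}.indicator (fun ω => g (X ω)) := by
    ext ω
    by_cases h : Z ω = z <;> simp [h]
  have h2 : ∫ ω, (({z} : Set α).indicator (fun _ => (1 : ℝ)) ∘ Z) ω ∂P
      = prr P {ω | Z ω = z} := by
    have : ({z} : Set α).indicator (fun _ => (1 : ℝ)) ∘ Z
        = {ω | Z ω = z}.indicator (fun _ => (1 : ℝ)) := by
      ext ω
      by_cases h : Z ω = z <;> simp [h]
    rw [this, integral_indicator hms]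
    simp [prr, Measure.real]
  rw [h1, h2, integral_indicator hms] at key
  exact key

theorem setIntegral_sub_const_eq {P : Measure Ω} [IsFiniteMeasure P] {X : Ω → ℝ}
    (hX : Integrable X P) (b : ℝ) (A : Set Ω) :
    ∫ ω in A, (X ω - b) ∂P = ∫ ω in A, X ω ∂P - b * prr P A := by
  rw [integral_sub hX.integrableOn (integrable_const b)]
  simp [prr, Measure.real, mul_comm]

theorem setIntegral_eq_cexp_mul {P : Measure Ω} {X : Ω → ℝ} {A : Set Ω} (hA : prr P A ≠ 0) :
    ∫ ω in A, X ω ∂P = cexp P X A * prr P A := by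
  rw [cexp, div_mul_cancel₀ _ hA]

theorem prr_pos {P : Measure Ω} [IsFiniteMeasure P] {A : Set Ω} (hA : 0 < P A) : 0 < prr P A :=
  ENNReal.toReal_pos hA.ne' (measure_ne_top P A)

/-- If the conditional mean on `A` is that on `A ∪ B`, with `A` and `B` disjoint, then the integral
over `B` is given by the same conditional mean. -/
theorem setIntegral_eq_cexp_mul_of_cexp_union_eq {P : Measure Ω} [IsFiniteMeasure P] {X : Ω → ℝ}
    (hX : Integrable X P) {A B C : Set Ω} (hC : C = A ∪ B) (hdisj : Disjoint A B)
    (hB : MeasurableSet B) (hA : 0 < P A) (h : cexp P X A = cexp P X C) :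
    ∫ ω in B, X ω ∂P = cexp P X C * prr P B := by
  subst hC
  have hAB : 0 < P (A ∪ B) := hA.trans_le (measure_mono Set.subset_union_left)
  have h1 := setIntegral_eq_cexp_mul (X := X) (prr_pos hAB).ne'
  have h2 := setIntegral_eq_cexp_mul (X := X) (prr_pos hA).ne'
  rw [setIntegral_union hdisj hB hX.integrableOn hX.integrableOn] at h1
  have h3 : prr P (A ∪ B) = prr P A + prr P B := by
    rw [prr, measure_union hdisj hB, ENNReal.toReal_add (measure_ne_top _ _) (measure_ne_top _ _)]
    rfl
  rw [h3] at h1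
  rw [h] at h2
  linarith

theorem measurableSet_grp3 {T : Fin 3 → Ω → Fin 3} (hT : ∀ z, Measurable (T z)) (a b c : Fin 3) :
    MeasurableSet (grp3 T a b c) :=
  (hT 0 (measurableSet_singleton a)).inter
    ((hT 1 (measurableSet_singleton b)).inter (hT 2 (measurableSet_singleton c)))

/-- If raising the value of `s` alone, relative to every other alternative, moves the strict
maximizer from `a` to `b`, then `b = a` or `b = s`. -/
theorem eq_or_eq_of_strict_max {ι : Type*} {s a b : ι} {V W x : ι → ℝ} {d : ℝ}
    (hother : ∀ t, t ≠ s → W t = V t + d) (hs : V s + d ≤ W s)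
    (hV : ∀ t, t ≠ a → V t + x t < V a + x a) (hW : ∀ t, t ≠ b → W t + x t < W b + x b) :
    b = a ∨ b = s := by
  by_contra! h
  have h1 := hV b h.1
  have h2 := hW a h.1.symm
  have h3 := hother b h.2
  by_cases ha : a = s
  · subst ha
    linarith
  · have h4 := hother a ha
    linarith

/-- Corollary (TSLS in the 3×3 model under strict, one-to-one targeting): under the
homogeneity and rank conditions, the TSLS coefficients identify the LATEs on the
1-compliers `𝒞₁` and the 2-compliers `𝒞₂`. -/
theorem statement15
    (P : Measure Ω) [IsProbabilityMeasure P]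
    (T : Fin 3 → Ω → Fin 3) (Z : Ω → Fin 3) (Y : Fin 3 → Ω → ℝ)
    (U : Fin 3 → Fin 3 → ℝ) (u : Fin 3 → Ω → ℝ)
    (hTmeas : ∀ z, Measurable (T z)) (hZmeas : Measurable Z)
    (hYmeas : ∀ t, Measurable (Y t)) (hYint : ∀ t, Integrable (Y t) P)
    (humeas : ∀ t, Measurable (u t))
    (hZpos : ∀ z, 0 < P {ω | Z ω = z})
    (hindep : IndepFun Z
      (fun ω => ((fun z => T z ω), (fun t => Y t ω), (fun t => u t ω))) P)
    (hmax : ∀ᵐ ω ∂P, ∀ z t, t ≠ T z ω →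
      U z t + u t ω < U z (T z ω) + u (T z ω) ω)
    (hΔ11 : U 0 1 - U 0 0 < U 1 1 - U 1 0)
    (hΔ21 : U 0 1 - U 0 0 = U 2 1 - U 2 0)
    (hΔ22 : U 0 2 - U 0 0 < U 2 2 - U 2 0)
    (hΔ12 : U 0 2 - U 0 0 = U 1 2 - U 1 0)
    -- the groups of 1-compliers and 2-compliers have positive probability
    (hC1 : 0 < P (grp3 T 0 1 0 ∪ grp3 T 0 1 2 ∪ grp3 T 1 1 2 ∪ grp3 T 2 1 2))
    (hC2 : 0 < P (grp3 T 0 0 2 ∪ grp3 T 0 1 2 ∪ grp3 T 1 1 2 ∪ grp3 T 2 1 2))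
    (hC112 : 0 < P (grp3 T 1 1 2)) (hC212 : 0 < P (grp3 T 2 1 2))
    -- homogeneity conditions
    (hhom1 : cexp P (fun ω => Y 1 ω - Y 0 ω) (grp3 T 1 1 2)
      = cexp P (fun ω => Y 1 ω - Y 0 ω)
          (grp3 T 0 1 0 ∪ grp3 T 0 1 2 ∪ grp3 T 1 1 2 ∪ grp3 T 2 1 2))
    (hhom2 : cexp P (fun ω => Y 2 ω - Y 0 ω) (grp3 T 2 1 2)
      = cexp P (fun ω => Y 2 ω - Y 0 ω)
          (grp3 T 0 0 2 ∪ grp3 T 0 1 2 ∪ grp3 T 1 1 2 ∪ grp3 T 2 1 2))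
    -- rank condition
    (hrank : prr P (grp3 T 0 1 0 ∪ grp3 T 0 1 2 ∪ grp3 T 2 1 2)
        * prr P (grp3 T 0 0 2 ∪ grp3 T 0 1 2 ∪ grp3 T 1 1 2)
      ≠ prr P (grp3 T 2 1 2) * prr P (grp3 T 1 1 2))
    (β₀ β₁ β₂ : ℝ)
    -- TSLS moment conditions
    (hmom : ∀ z : Fin 3,
      ∫ ω in {ω | Z ω = z},
        (Y (T (Z ω) ω) ω - β₀
          - β₁ * (if T (Z ω) ω = 1 then (1 : ℝ) else 0)
          - β₂ * (if T (Z ω) ω = 2 then (1 : ℝ) else 0)) ∂P = 0) :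
    β₁ = cexp P (fun ω => Y 1 ω - Y 0 ω)
          (grp3 T 0 1 0 ∪ grp3 T 0 1 2 ∪ grp3 T 1 1 2 ∪ grp3 T 2 1 2)
    ∧ β₂ = cexp P (fun ω => Y 2 ω - Y 0 ω)
          (grp3 T 0 0 2 ∪ grp3 T 0 1 2 ∪ grp3 T 1 1 2 ∪ grp3 T 2 1 2) := by
  set V : Fin 3 → Ω → ℝ := fun z ω => Y (T z ω) ω
    - β₁ * (if T z ω = 1 then (1 : ℝ) else 0) - β₂ * (if T z ω = 2 then (1 : ℝ) else 0)
  have hind : ∀ (z t : Fin 3) (c : ℝ),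
      Integrable (fun ω => c * (if T z ω = t then (1 : ℝ) else 0)) P := fun z t c =>
    (((integrable_const (1 : ℝ)).indicator (hTmeas z (measurableSet_singleton t))).congr
      (ae_of_all _ fun ω => by by_cases h : T z ω = t <;> simp [h])).const_mul c
  have hYT : ∀ z, Integrable (fun ω => Y (T z ω) ω) P := by
    intro z
    have h : Integrable
        (fun ω => ∑ t, {ω | T z ω = t}.indicator (Y t) ω) P :=
      integrable_finsetSum _ fun t _ =>
        (hYint t).indicator (hTmeas z (measurableSet_singleton t))
    refine h.congr (ae_of_all _ fun ω => ?_)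
    simp [Set.indicator_apply]
  have hVint : ∀ z, Integrable (V z) P := fun z => ((hYT z).sub (hind z 1 β₁)).sub (hind z 2 β₂)
  have hmean : ∀ z, ∫ ω, V z ω ∂P = β₀ := by
    intro z
    let g : (Fin 3 → Fin 3) × (Fin 3 → ℝ) × (Fin 3 → ℝ) → ℝ := fun p =>
      p.2.1 (p.1 z) - β₀ - β₁ * (if p.1 z = 1 then (1 : ℝ) else 0)
        - β₂ * (if p.1 z = 2 then (1 : ℝ) else 0)
    have hpz : Measurable fun p : (Fin 3 → Fin 3) × (Fin 3 → ℝ) × (Fin 3 → ℝ) => p.1 z :=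
      (measurable_pi_apply z).comp measurable_fst
    have hg : Measurable g := by
      have h1 : Measurable fun p : (Fin 3 → Fin 3) × (Fin 3 → ℝ) × (Fin 3 → ℝ) =>
          p.2.1 (p.1 z) := by
        have h : Measurable fun p : (Fin 3 → Fin 3) × (Fin 3 → ℝ) × (Fin 3 → ℝ) =>
            ∑ t, {p : (Fin 3 → Fin 3) × (Fin 3 → ℝ) × (Fin 3 → ℝ) | p.1 z = t}.indicator
              (fun p => p.2.1 t) p :=
          Finset.measurable_fun_sum _ fun t _ =>
            Measurable.indicator (by fun_prop) (hpz (measurableSet_singleton t))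
        convert h using 2 with p
        simp [Set.indicator_apply]
      have h2 : ∀ t : Fin 3, Measurable fun p : (Fin 3 → Fin 3) × (Fin 3 → ℝ) × (Fin 3 → ℝ) =>
          (if p.1 z = t then (1 : ℝ) else 0) := fun t =>
        Measurable.ite (hpz (measurableSet_singleton t)) measurable_const measurable_const
      exact ((h1.sub_const β₀).sub ((h2 1).const_mul β₁)).sub ((h2 2).const_mul β₂)
    have hX : Measurable
        (fun ω => ((fun z => T z ω), (fun t => Y t ω), (fun t => u t ω))) :=
      (measurable_pi_lambda _ hTmeas).prodMk
        ((measurable_pi_lambda _ hYmeas).prodMk (measurable_pi_lambda _ humeas))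
    have hfac := setIntegral_preimage_eq_mul_of_indepFun hZmeas hX hindep z hg
    have hzero := hmom z
    rw [setIntegral_congr_fun (s := {ω | Z ω = z}) (g := fun ω => g ((fun z => T z ω),
      (fun t => Y t ω), (fun t => u t ω))) (hZmeas (measurableSet_singleton z))
      (fun ω (hω : Z ω = z) => by simp only [hω, g]), hfac] at hzero
    have h0 := (mul_eq_zero.mp hzero).resolve_left (prr_pos (hZpos z)).ne'
    have hsub : ∫ ω, (V z ω - β₀) ∂P = 0 := by
      rw [← h0]
      congr 1
      ext ω
      simp only [V, g]
      ring
    rw [integral_sub (hVint z) (integrable_const β₀)] at hsub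
    simp only [integral_const, probReal_univ, one_smul] at hsub
    linarith
  have hsupp : ∀ᵐ ω ∂P, (T 1 ω = T 0 ω ∨ T 1 ω = 1) ∧ (T 0 ω = 1 → T 1 ω = 1) ∧
      (T 2 ω = T 0 ω ∨ T 2 ω = 2) ∧ (T 0 ω = 2 → T 2 ω = 2) := by
    filter_upwards [hmax] with ω hω
    have e1 : ∀ t : Fin 3, t ≠ 1 → U 1 t = U 0 t + (U 1 0 - U 0 0) := by
      intro t ht
      fin_cases t
      · simp
      · simp at ht
      · simp only [Fin.reduceFinMk]; linarith
    have e2 : ∀ t : Fin 3, t ≠ 2 → U 2 t = U 0 t + (U 2 0 - U 0 0) := by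
      intro t ht
      fin_cases t
      · simp
      · simp only [Fin.mk_one]; linarith
      · simp at ht
    refine ⟨eq_or_eq_of_strict_max e1 (by linarith) (hω 0) (hω 1), fun h => ?_,
      eq_or_eq_of_strict_max e2 (by linarith) (hω 0) (hω 2), fun h => ?_⟩
    · by_contra hne
      have a1 := hω 0 (T 1 ω) (by rw [h]; exact hne)
      have a2 := hω 1 1 (Ne.symm hne)
      have a3 := e1 _ hne
      rw [h] at a1
      linarith
    · by_contra hne
      have a1 := hω 0 (T 2 ω) (by rw [h]; exact hne)
      have a2 := hω 2 2 (Ne.symm hne)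
      have a3 := e2 _ hne
      rw [h] at a1
      linarith
  have hG := measurableSet_grp3 hTmeas
  set B₁ := grp3 T 0 1 0 ∪ grp3 T 0 1 2 ∪ grp3 T 2 1 2
  set B₂ := grp3 T 0 0 2 ∪ grp3 T 0 1 2 ∪ grp3 T 1 1 2
  have hB₁m : MeasurableSet B₁ := ((hG _ _ _).union (hG _ _ _)).union (hG _ _ _)
  have hB₂m : MeasurableSet B₂ := ((hG _ _ _).union (hG _ _ _)).union (hG _ _ _)
  set D₁ : Ω → ℝ := fun ω => Y 1 ω - Y 0 ω
  set D₂ : Ω → ℝ := fun ω => Y 2 ω - Y 0 ω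
  have hD₁i : Integrable D₁ P := (hYint 1).sub (hYint 0)
  have hD₂i : Integrable D₂ P := (hYint 2).sub (hYint 0)
  have hD₁b : Integrable (fun ω => D₁ ω - β₁) P := hD₁i.sub (integrable_const _)
  have hD₂b : Integrable (fun ω => D₂ ω - β₂) P := hD₂i.sub (integrable_const _)
  have hcases : ∀ t : Fin 3, t = 0 ∨ t = 1 ∨ t = 2 := by decide
  have hdiff₁ : ∀ᵐ ω ∂P, V 1 ω - V 0 ω = B₁.indicator (fun ω => D₁ ω - β₁) ω
      - (grp3 T 2 1 2).indicator (fun ω => D₂ ω - β₂) ω := by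
    filter_upwards [hsupp] with ω hω
    simp only [V, B₁, D₁, D₂, Set.indicator_apply, Set.mem_union, grp3, Set.mem_ofPred_eq]
    rcases hcases (T 0 ω) with ha | ha | ha <;> rcases hcases (T 1 ω) with hb | hb | hb <;>
      rcases hcases (T 2 ω) with hc | hc | hc <;> simp [ha, hb, hc] at hω ⊢ <;> ring
  have hdiff₂ : ∀ᵐ ω ∂P, V 2 ω - V 0 ω = B₂.indicator (fun ω => D₂ ω - β₂) ω
      - (grp3 T 1 1 2).indicator (fun ω => D₁ ω - β₁) ω := by
    filter_upwards [hsupp] with ω hω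
    simp only [V, B₂, D₁, D₂, Set.indicator_apply, Set.mem_union, grp3, Set.mem_ofPred_eq]
    rcases hcases (T 0 ω) with ha | ha | ha <;> rcases hcases (T 1 ω) with hb | hb | hb <;>
      rcases hcases (T 2 ω) with hc | hc | hc <;> simp [ha, hb, hc] at hω ⊢ <;> ring
  have heq₁ := integral_congr_ae hdiff₁
  have heq₂ := integral_congr_ae hdiff₂
  rw [integral_sub (hVint 1) (hVint 0), hmean, hmean, integral_sub (hD₁b.indicator hB₁m)
    (hD₂b.indicator (hG _ _ _)), integral_indicator hB₁m, integral_indicator (hG _ _ _),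
    setIntegral_sub_const_eq hD₁i, setIntegral_sub_const_eq hD₂i] at heq₁
  rw [integral_sub (hVint 2) (hVint 0), hmean, hmean, integral_sub (hD₂b.indicator hB₂m)
    (hD₁b.indicator (hG _ _ _)), integral_indicator hB₂m, integral_indicator (hG _ _ _),
    setIntegral_sub_const_eq hD₁i, setIntegral_sub_const_eq hD₂i] at heq₂
  have hI₁ := setIntegral_eq_cexp_mul_of_cexp_union_eq hD₁i (B := B₁)
    (by ext ω; simp only [B₁, Set.mem_union]; tauto)
    (Set.disjoint_left.mpr fun ω h h' => by
      rcases h with ⟨h1, -, -⟩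
      rcases h' with (⟨h2, -, -⟩ | ⟨h2, -, -⟩) | ⟨h2, -, -⟩ <;> simp [h1] at h2)
    hB₁m hC112 hhom1
  have hI₂ := setIntegral_eq_cexp_mul_of_cexp_union_eq hD₂i (B := B₂)
    (by ext ω; simp only [B₂, Set.mem_union]; tauto)
    (Set.disjoint_left.mpr fun ω h h' => by
      rcases h with ⟨h1, -, -⟩
      rcases h' with (⟨h2, -, -⟩ | ⟨h2, -, -⟩) | ⟨h2, -, -⟩ <;> simp [h1] at h2)
    hB₂m hC212 hhom2
  rw [hI₁, setIntegral_eq_cexp_mul (prr_pos hC212).ne', hhom2] at heq₁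
  rw [hI₂, setIntegral_eq_cexp_mul (prr_pos hC112).ne', hhom1] at heq₂
  generalize cexp P D₁ _ = l₁ at heq₁ heq₂ ⊢
  generalize cexp P D₂ _ = l₂ at heq₁ heq₂ ⊢
  have hdet := sub_ne_zero.mpr hrank
  constructor
  · apply mul_right_cancel₀ hdet
    linear_combination prr P B₂ * heq₁ + prr P (grp3 T 2 1 2) * heq₂
  · apply mul_right_cancel₀ hdet
    linear_combination prr P B₁ * heq₂ + prr P (grp3 T 1 1 2) * heq₁
end
end

section
/- In the M₁-filtered 2×T ARUM with strict one-to-one targeting: (i) the three D-response-group probabilities are point-identified: P(A₁ᴰ) = Pᴰ(1|0), P(A₀ᴰ) = 1 − Pᴰ(1|1), and P(C₀₁ᴰ) = Pᴰ(1|1) − Pᴰ(1|0), with the testable implication Pᴰ(1|1) ≥ Pᴰ(1|0); (ii) assuming positive denominators, E[Y(T(0)) | A₀ᴰ] = Ēᴰ_1(0) / (1 − Pᴰ(1|1)) and E[Y(1) | A₁ᴰ] = Ēᴰ_0(1) / Pᴰ(1|0); (iii) assuming P(C₀₁ᴰ) > 0 and P(C_{t1}) > 0 for t ≠ 1, the Wald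 estimand satisfies (E[Y | Z = 1] − E[Y | Z = 0]) / (Pᴰ(1|1) − Pᴰ(1|0)) = E[Y(1) | C₀₁ᴰ] − Σ_{t ≠ 1} α_t · E[Y(t) | C_{t1}], where α_t := P(C_{t1}) / P(C₀₁ᴰ) are positive weights summing to 1. -/
open MeasureTheory ProbabilityTheory

noncomputable section

variable {Ω : Type*} [MeasurableSpace Ω]

/-- The `M₁` filter: `D = 1(T = 1)`. -/
def m1 {k : ℕ} (t : Fin (k + 2)) : ℕ := if t = 1 then 1 else 0

theorem m1_eq_one_iff {k : ℕ} (t : Fin (k + 2)) : m1 t = 1 ↔ t = 1 := by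
  unfold m1; split_ifs with h <;> simp [h]

theorem m1_eq_zero_iff {k : ℕ} (t : Fin (k + 2)) : m1 t = 0 ↔ t ≠ 1 := by
  unfold m1; split_ifs with h <;> simp [h]

/-- Conditioning a function of `V` on the value of an independent variable. -/
theorem setIntegral_eq_mul_of_indepFun {𝒵 𝒱 : Type*} [MeasurableSpace 𝒵]
    [MeasurableSingletonClass 𝒵] [MeasurableSpace 𝒱] {P : Measure Ω}
    {Z : Ω → 𝒵} {V : Ω → 𝒱} (hZ : Measurable Z) (hV : Measurable V) (hindep : IndepFun Z V P)
    {f : 𝒱 → ℝ} (hf : Measurable f) (z : 𝒵) :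
    ∫ ω in {ω | Z ω = z}, f (V ω) ∂P = prr P {ω | Z ω = z} * ∫ ω, f (V ω) ∂P :=
  Indep.setIntegral_eq_mul hZ.comap_le hindep hV.aemeasurable
    ⟨{z}, measurableSet_singleton z, rfl⟩ hf.aestronglyMeasurable

theorem measurable_eval_index {ι : Type*} [Countable ι] [MeasurableSpace ι]
    [MeasurableSingletonClass ι] : Measurable fun v : ι × (ι → ℝ) => v.2 v.1 :=
  measurable_from_prod_countable_right fun i => measurable_pi_apply i

/-- A randomly selected outcome among finitely many integrable ones is integrable. -/
theorem integrable_selected {ι : Type*} [Fintype ι] [MeasurableSpace ι]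
    [MeasurableSingletonClass ι] {P : Measure Ω} {S : Ω → ι} {Y : ι → Ω → ℝ} (hS : Measurable S)
    (hYint : ∀ t, Integrable (Y t) P) : Integrable (fun ω => Y (S ω) ω) P := by
  classical
  have h : (fun ω => Y (S ω) ω) = fun ω => ∑ t, {ω | S ω = t}.indicator (Y t) ω := by
    ext ω
    simp [Set.indicator_apply]
  rw [h]
  exact integrable_finsetSum _ fun t _ =>
    (hYint t).indicator (measurableSet_eq_fun hS measurable_const)

section Identification

variable {n : ℕ} {P : Measure Ω} [IsProbabilityMeasure P]
  {T : Fin 2 → Ω → Fin (n + 2)} {Z : Ω → Fin 2} {Y : Fin (n + 2) → Ω → ℝ}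

theorem ecz_eq_integral (hTmeas : ∀ z, Measurable (T z)) (hZmeas : Measurable Z)
    (hYmeas : ∀ t, Measurable (Y t)) {z : Fin 2} (hZpos : 0 < P {ω | Z ω = z})
    (hindep : IndepFun Z (fun ω => (T z ω, fun t => Y t ω)) P) :
    ecz P Z (fun ω => Y (T (Z ω) ω) ω) z = ∫ ω, Y (T z ω) ω ∂P := by
  have hz : prr P {ω | Z ω = z} ≠ 0 :=
    (ENNReal.toReal_pos hZpos.ne' (measure_ne_top _ _)).ne'
  have hcongr : ∫ ω in {ω | Z ω = z}, Y (T (Z ω) ω) ω ∂P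
      = ∫ ω in {ω | Z ω = z}, Y (T z ω) ω ∂P :=
    setIntegral_congr_fun (measurableSet_eq_fun hZmeas measurable_const)
      fun ω (hω : Z ω = z) => by simp only [hω]
  have h := setIntegral_eq_mul_of_indepFun hZmeas
    ((hTmeas z).prodMk (measurable_pi_lambda _ hYmeas)) hindep measurable_eval_index z
  rw [ecz, hcongr, h, mul_div_cancel_left₀ _ hz]

theorem ebar_eq_setIntegral (hTmeas : ∀ z, Measurable (T z)) (hZmeas : Measurable Z)
    (hYmeas : ∀ t, Measurable (Y t)) {z : Fin 2} (hZpos : 0 < P {ω | Z ω = z})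
    (hindep : IndepFun Z (fun ω => (T z ω, fun t => Y t ω)) P) (d : ℕ) :
    ebar P (fun ω => m1 (T (Z ω) ω)) Z (fun ω => Y (T (Z ω) ω) ω) z d
      = ∫ ω in {ω | m1 (T z ω) = d}, Y (T z ω) ω ∂P := by
  have hz : prr P {ω | Z ω = z} ≠ 0 :=
    (ENNReal.toReal_pos hZpos.ne' (measure_ne_top _ _)).ne'
  have hD : MeasurableSet {ω | m1 (T z ω) = d} :=
    hTmeas z (Set.toFinite {t | m1 t = d}).measurableSet
  have hS : {ω | m1 (T (Z ω) ω) = d} ∩ {ω | Z ω = z}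
      = {ω | Z ω = z} ∩ {ω | m1 (T z ω) = d} := by
    ext ω
    constructor
    · rintro ⟨h, h' : Z ω = z⟩
      subst h'
      exact ⟨rfl, h⟩
    · rintro ⟨h' : Z ω = z, h⟩
      subst h'
      exact ⟨h, rfl⟩
  have hZset : MeasurableSet {ω | Z ω = z} := measurableSet_eq_fun hZmeas measurable_const
  have hcongr : ∫ ω in {ω | Z ω = z} ∩ {ω | m1 (T z ω) = d}, Y (T (Z ω) ω) ω ∂P
      = ∫ ω in {ω | Z ω = z} ∩ {ω | m1 (T z ω) = d}, Y (T z ω) ω ∂P :=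
    setIntegral_congr_fun (hZset.inter hD) fun ω ⟨(hω : Z ω = z), _⟩ => by simp only [hω]
  have hf : Measurable ({v : Fin (n + 2) × (Fin (n + 2) → ℝ) | m1 v.1 = d}.indicator
      fun v => v.2 v.1) :=
    measurable_eval_index.indicator (measurable_fst (Set.toFinite {t | m1 t = d}).measurableSet)
  have h := setIntegral_eq_mul_of_indepFun hZmeas
    ((hTmeas z).prodMk (measurable_pi_lambda _ hYmeas)) hindep hf z
  have hind : (fun ω => ({v : Fin (n + 2) × (Fin (n + 2) → ℝ) | m1 v.1 = d}.indicator
      (fun v => v.2 v.1)) (T z ω, fun t => Y t ω))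
      = {ω | m1 (T z ω) = d}.indicator fun ω => Y (T z ω) ω := rfl
  simp only [hind] at h
  rw [setIntegral_indicator hD, integral_indicator hD] at h
  rw [ebar, hS, hcongr, h, mul_div_cancel_left₀ _ hz]

theorem pscore_eq_prr (hTmeas : ∀ z, Measurable (T z)) (hZmeas : Measurable Z) {z : Fin 2}
    (hZpos : 0 < P {ω | Z ω = z})
    (hindep : IndepFun Z (T z) P) (d : ℕ) :
    pscore P (fun ω => m1 (T (Z ω) ω)) Z d z = prr P {ω | m1 (T z ω) = d} := by
  have h := ebar_eq_setIntegral (Y := fun _ _ => (1 : ℝ)) hTmeas hZmeas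
    (fun _ => measurable_const) hZpos
    (hindep.comp measurable_id (measurable_id.prodMk (measurable_const (a := fun _ => (1 : ℝ))))) d
  simpa [ebar, pscore, prr, measureReal_def] using h

end Identification

/-- Raising the relative value of treatment `1` alone can only move agents into treatment `1`. -/
theorem eq_or_eq_one_of_strict_targeting {ι : Type*} {a o : ι} {U₀ U₁ u : ι → ℝ} {s t : ι}
    (hs : ∀ r, r ≠ s → U₀ r + u r < U₀ s + u s) (ht : ∀ r, r ≠ t → U₁ r + u r < U₁ t + u t)
    (ha : U₀ a - U₀ o < U₁ a - U₁ o) (hne : ∀ r, r ≠ a → U₁ r - U₁ o = U₀ r - U₀ o) :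
    s = t ∨ t = a := by
  by_contra! h
  have h₁ := hs t h.1.symm
  have h₂ := ht s h.1
  have h₃ := hne t h.2
  by_cases hsa : s = a
  · subst hsa
    linarith
  · have h₄ := hne s hsa
    linarith

/-- Proposition (identification in the `M₁`-filtered 2×T model). -/
theorem statement16
    (P : Measure Ω) [IsProbabilityMeasure P] (n : ℕ)
    (T : Fin 2 → Ω → Fin (n + 2)) (Z : Ω → Fin 2) (Y : Fin (n + 2) → Ω → ℝ)
    (U : Fin 2 → Fin (n + 2) → ℝ) (u : Fin (n + 2) → Ω → ℝ)
    (hTmeas : ∀ z, Measurable (T z)) (hZmeas : Measurable Z)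
    (hYmeas : ∀ t, Measurable (Y t)) (hYint : ∀ t, Integrable (Y t) P)
    (humeas : ∀ t, Measurable (u t))
    (hZpos : ∀ z, 0 < P {ω | Z ω = z})
    (hindep : IndepFun Z
      (fun ω => ((fun z => T z ω), (fun t => Y t ω), (fun t => u t ω))) P)
    (hmax : ∀ᵐ ω ∂P, ∀ z t, t ≠ T z ω →
      U z t + u t ω < U z (T z ω) + u (T z ω) ω)
    (hΔ1 : U 0 1 - U 0 0 < U 1 1 - U 1 0)
    (hΔt : ∀ t : Fin (n + 2), t ≠ 1 → U 1 t - U 1 0 = U 0 t - U 0 0)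
    -- positive denominators for part (ii)
    (hden1 : pscore P (fun ω => m1 (T (Z ω) ω)) Z 1 1 < 1)
    (hden2 : 0 < pscore P (fun ω => m1 (T (Z ω) ω)) Z 1 0)
    -- positive complier-group probabilities for part (iii)
    (hC01D : 0 < P {ω | m1 (T 0 ω) = 0 ∧ m1 (T 1 ω) = 1})
    (hCt : ∀ t : Fin (n + 2), t ≠ 1 → 0 < P {ω | T 0 ω = t ∧ T 1 ω = 1}) :
    -- (i) the three D-response-group probabilities are point-identified
    prr P {ω | m1 (T 0 ω) = 1 ∧ m1 (T 1 ω) = 1}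
        = pscore P (fun ω => m1 (T (Z ω) ω)) Z 1 0
    ∧ prr P {ω | m1 (T 0 ω) = 0 ∧ m1 (T 1 ω) = 0}
        = 1 - pscore P (fun ω => m1 (T (Z ω) ω)) Z 1 1
    ∧ prr P {ω | m1 (T 0 ω) = 0 ∧ m1 (T 1 ω) = 1}
        = pscore P (fun ω => m1 (T (Z ω) ω)) Z 1 1
          - pscore P (fun ω => m1 (T (Z ω) ω)) Z 1 0
    ∧ pscore P (fun ω => m1 (T (Z ω) ω)) Z 1 0
        ≤ pscore P (fun ω => m1 (T (Z ω) ω)) Z 1 1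
    -- (ii) counterfactual means for the always-takers
    ∧ cexp P (fun ω => Y (T 0 ω) ω) {ω | m1 (T 0 ω) = 0 ∧ m1 (T 1 ω) = 0}
        = ebar P (fun ω => m1 (T (Z ω) ω)) Z (fun ω => Y (T (Z ω) ω) ω) 1 0
          / (1 - pscore P (fun ω => m1 (T (Z ω) ω)) Z 1 1)
    ∧ cexp P (Y 1) {ω | m1 (T 0 ω) = 1 ∧ m1 (T 1 ω) = 1}
        = ebar P (fun ω => m1 (T (Z ω) ω)) Z (fun ω => Y (T (Z ω) ω) ω) 0 1
          / pscore P (fun ω => m1 (T (Z ω) ω)) Z 1 0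
    -- (iii) the Wald estimand
    ∧ (ecz P Z (fun ω => Y (T (Z ω) ω) ω) 1 - ecz P Z (fun ω => Y (T (Z ω) ω) ω) 0)
        / (pscore P (fun ω => m1 (T (Z ω) ω)) Z 1 1
            - pscore P (fun ω => m1 (T (Z ω) ω)) Z 1 0)
      = cexp P (Y 1) {ω | m1 (T 0 ω) = 0 ∧ m1 (T 1 ω) = 1}
        - ∑ t ∈ Finset.univ.erase 1,
            (prr P {ω | T 0 ω = t ∧ T 1 ω = 1}
                / prr P {ω | m1 (T 0 ω) = 0 ∧ m1 (T 1 ω) = 1})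
              * cexp P (Y t) {ω | T 0 ω = t ∧ T 1 ω = 1}
    ∧ (∀ t : Fin (n + 2), t ≠ 1 →
        0 < prr P {ω | T 0 ω = t ∧ T 1 ω = 1}
            / prr P {ω | m1 (T 0 ω) = 0 ∧ m1 (T 1 ω) = 1})
    ∧ ∑ t ∈ Finset.univ.erase 1,
        prr P {ω | T 0 ω = t ∧ T 1 ω = 1}
          / prr P {ω | m1 (T 0 ω) = 0 ∧ m1 (T 1 ω) = 1}
        = 1 := by
  have hI (z : Fin 2) : IndepFun Z (fun ω => (T z ω, fun t => Y t ω)) P :=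
    hindep.comp measurable_id
      (((measurable_pi_apply z).comp measurable_fst).prodMk (measurable_fst.comp measurable_snd))
  have hIT (z : Fin 2) : IndepFun Z (T z) P := (hI z).comp measurable_id measurable_fst
  have hps (z : Fin 2) (d : ℕ) := pscore_eq_prr hTmeas hZmeas (hZpos z) (hIT z) d
  have heb (z : Fin 2) (d : ℕ) := ebar_eq_setIntegral hTmeas hZmeas hYmeas (hZpos z) (hI z) d
  have hec (z : Fin 2) := ecz_eq_integral hTmeas hZmeas hYmeas (hZpos z) (hI z)
  have hmono : ∀ᵐ ω ∂P, T 0 ω = T 1 ω ∨ T 1 ω = 1 := by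
    filter_upwards [hmax] with ω hω
    exact eq_or_eq_one_of_strict_targeting (u := fun t => u t ω) (hω 0) (hω 1) hΔ1 hΔt
  have hDset (z : Fin 2) (d : ℕ) : MeasurableSet {ω | m1 (T z ω) = d} :=
    hTmeas z (Set.toFinite {t | m1 t = d}).measurableSet
  have hTset (z : Fin 2) (t : Fin (n + 2)) : MeasurableSet {ω | T z ω = t} :=
    hTmeas z (measurableSet_singleton t)
  have hA1 : ({ω | m1 (T 0 ω) = 1 ∧ m1 (T 1 ω) = 1} : Set Ω) =ᵐ[P] {ω | m1 (T 0 ω) = 1} := by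
    filter_upwards [hmono] with ω hω
    apply propext
    change (m1 (T 0 ω) = 1 ∧ m1 (T 1 ω) = 1) ↔ m1 (T 0 ω) = 1
    simp only [m1_eq_one_iff]
    grind
  have hA0 : ({ω | m1 (T 0 ω) = 0 ∧ m1 (T 1 ω) = 0} : Set Ω) =ᵐ[P] {ω | m1 (T 1 ω) = 0} := by
    filter_upwards [hmono] with ω hω
    apply propext
    change (m1 (T 0 ω) = 0 ∧ m1 (T 1 ω) = 0) ↔ m1 (T 1 ω) = 0
    simp only [m1_eq_zero_iff]
    grind
  have hpA1 : prr P {ω | m1 (T 0 ω) = 1 ∧ m1 (T 1 ω) = 1} = prr P {ω | m1 (T 0 ω) = 1} :=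
    congrArg ENNReal.toReal (measure_congr hA1)
  have hpA0 : prr P {ω | m1 (T 0 ω) = 0 ∧ m1 (T 1 ω) = 0} = 1 - prr P {ω | m1 (T 1 ω) = 1} := by
    have hcompl : {ω | m1 (T 1 ω) = 0} = {ω | m1 (T 1 ω) = 1}ᶜ := by
      ext ω
      change m1 (T 1 ω) = 0 ↔ ¬ m1 (T 1 ω) = 1
      rw [m1_eq_zero_iff, m1_eq_one_iff]
    calc _ = P.real {ω | m1 (T 1 ω) = 0} := congrArg ENNReal.toReal (measure_congr hA0)
      _ = _ := by rw [hcompl, probReal_compl_eq_one_sub (hDset 1 1)]; rfl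
  have hpC : prr P {ω | m1 (T 0 ω) = 0 ∧ m1 (T 1 ω) = 1}
      = prr P {ω | m1 (T 1 ω) = 1} - prr P {ω | m1 (T 0 ω) = 1} := by
    have hdiff : {ω | m1 (T 0 ω) = 0 ∧ m1 (T 1 ω) = 1}
        = {ω | m1 (T 1 ω) = 1} \ {ω | m1 (T 0 ω) = 1 ∧ m1 (T 1 ω) = 1} := by
      ext ω
      change (m1 (T 0 ω) = 0 ∧ m1 (T 1 ω) = 1)
        ↔ m1 (T 1 ω) = 1 ∧ ¬ (m1 (T 0 ω) = 1 ∧ m1 (T 1 ω) = 1)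
      rw [m1_eq_zero_iff, m1_eq_one_iff, m1_eq_one_iff]
      tauto
    rw [← hpA1, hdiff]
    exact measureReal_sdiff (fun ω hω => hω.2) ((hDset 0 1).inter (hDset 1 1))
  have hCpos : 0 < prr P {ω | m1 (T 0 ω) = 0 ∧ m1 (T 1 ω) = 1} :=
    ENNReal.toReal_pos hC01D.ne' (measure_ne_top _ _)
  have hCtpos (t : Fin (n + 2)) (ht : t ≠ 1) : 0 < prr P {ω | T 0 ω = t ∧ T 1 ω = 1} :=
    ENNReal.toReal_pos (hCt t ht).ne' (measure_ne_top _ _)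
  have hCset : MeasurableSet {ω | m1 (T 0 ω) = 0 ∧ m1 (T 1 ω) = 1} :=
    (hDset 0 0).inter (hDset 1 1)
  have hCtset (t : Fin (n + 2)) : MeasurableSet {ω | T 0 ω = t ∧ T 1 ω = 1} :=
    (hTset 0 t).inter (hTset 1 1)
  have hsum : ∑ t ∈ Finset.univ.erase 1, prr P {ω | T 0 ω = t ∧ T 1 ω = 1}
      = prr P {ω | m1 (T 0 ω) = 0 ∧ m1 (T 1 ω) = 1} := by
    have hunion : {ω | m1 (T 0 ω) = 0 ∧ m1 (T 1 ω) = 1}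
        = ⋃ t ∈ Finset.univ.erase (1 : Fin (n + 2)), {ω | T 0 ω = t ∧ T 1 ω = 1} := by
      ext ω
      simp [m1_eq_zero_iff, m1_eq_one_iff]
    rw [hunion]
    refine (measureReal_biUnion_finset (μ := P) (fun s _ t _ hst => ?_) fun t _ => hCtset t).symm
    exact Set.disjoint_left.2 fun ω h h' => hst (h.1.symm.trans h'.1)
  have hWald : (∫ ω, Y (T 1 ω) ω ∂P) - ∫ ω, Y (T 0 ω) ω ∂P
      = (∫ ω in {ω | m1 (T 0 ω) = 0 ∧ m1 (T 1 ω) = 1}, Y 1 ω ∂P)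
        - ∑ t ∈ Finset.univ.erase 1, ∫ ω in {ω | T 0 ω = t ∧ T 1 ω = 1}, Y t ω ∂P := by
    simp only [← integral_indicator hCset, ← integral_indicator (hCtset _)]
    rw [← integral_sub (integrable_selected (hTmeas 1) hYint)
        (integrable_selected (hTmeas 0) hYint),
      ← integral_finsetSum _ fun t _ => (hYint t).indicator (hCtset t),
      ← integral_sub ((hYint 1).indicator hCset)
        (integrable_finsetSum _ fun t _ => (hYint t).indicator (hCtset t))]
    refine integral_congr_ae ?_
    filter_upwards [hmono] with ω hω
    simp only [Set.indicator_apply, Set.mem_ofPred_eq, m1_eq_zero_iff, m1_eq_one_iff]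
    by_cases h1 : T 1 ω = 1
    · by_cases h0 : T 0 ω = 1 <;> simp [h0, h1, Finset.sum_ite_eq]
    · simp [h1, hω.resolve_right h1]
  simp only [hps, heb, hec, hWald]
  refine ⟨hpA1, hpA0, hpC, by linarith, ?_, ?_, ?_, fun t ht => div_pos (hCtpos t ht) hCpos, ?_⟩
  · rw [cexp, hpA0, setIntegral_congr_set hA0]
    congr 1
    refine setIntegral_congr_ae (hDset 1 0) ?_
    filter_upwards [hmono] with ω hω h
    rw [hω.resolve_right ((m1_eq_zero_iff _).1 h)]
  · rw [cexp, hpA1, setIntegral_congr_set hA1]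
    congr 1
    refine setIntegral_congr_fun (hDset 0 1) fun ω h => ?_
    simp only [(m1_eq_one_iff _).1 h]
  · rw [← hpC, sub_div, Finset.sum_div]
    refine congrArg _ (Finset.sum_congr rfl fun t ht => ?_)
    have := (hCtpos t (Finset.ne_of_mem_erase ht)).ne'
    rw [cexp]
    field_simp
  · rw [← Finset.sum_div, hsum, div_self hCpos.ne']
end
end
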